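/- For all real (or complex) x, y and every natural number n, ∑_{k=0}^{⌊n/2⌋} (C(n,k) − C(n,k−1)) · (∑_{j=k}^{n−k} x^j y^{n−j}) = (x+y)^n. -/

import Mathlib

/-- Number of standard Young tableaux of the two-row shape `(n-k, k)`,
`f^λ = C(n,k) - C(n,k-1)`, with the convention `C(n,-1) = 0`. -/
def twoRowSYT (n k : ℕ) : ℤ :=
  (n.choose k : ℤ) - (if k = 0 then 0 else (n.choose (k - 1) : ℤ))

theorem sum_twoRowSYT (n m : ℕ) :
    ∑ k ∈ Finset.range (m + 1), twoRowSYT n k = n.choose m := by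
  induction m with
  | zero => simp [twoRowSYT]
  | succ m ih =>
    rw [Finset.sum_range_succ, ih]
    simp [twoRowSYT]

theorem choose_min_sub {n j : ℕ} (h : j ≤ n) : n.choose (min j (n - j)) = n.choose j := by
  rcases min_choice j (n - j) with h' | h' <;> rw [h']
  exact Nat.choose_symm h

theorem schur_weyl_trace_decomposition (x y : ℝ) (n : ℕ) :
    ∑ k ∈ Finset.range (n / 2 + 1),
      (twoRowSYT n k : ℝ) * ∑ j ∈ Finset.Icc k (n - k), x ^ j * y ^ (n - j) =
    (x + y) ^ n := by
  simp_rw [Finset.mul_sum]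
  rw [Finset.sum_comm' (t' := Finset.range (n + 1))
    (s' := fun j => Finset.range (min j (n - j) + 1)), add_pow]
  · refine Finset.sum_congr rfl fun j hj => ?_
    rw [← Finset.sum_mul, ← Int.cast_sum, sum_twoRowSYT,
      choose_min_sub (Nat.lt_succ_iff.mp (Finset.mem_range.mp hj)), Int.cast_natCast, mul_comm]
  · intro k j
    simp only [Finset.mem_range, Finset.mem_Icc]
    omega
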